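/- For every n ≥ 5 there exists a real polynomial Q of degree n−1 having n−1 distinct real roots such that for every c ∈ ℝ the polynomial ∫₀^X Q(t) dt − c does not have n distinct real roots (i.e. Q has no primitive with n distinct real roots). In particular, for n = 5 the polynomial Q(X) = 5X(X − 1)(X − 3)(X − π) has this property: for every c ∈ ℝ, the quintic X⁵ − (5π/4 + 5)X⁴ + (20π/3 + 5)X³ − (15π/2)X² − c does not have 5 distinct real roots. -/

import Mathlib

open Polynomial

/-- `Q` decreases its primitives along `[u, v]` and `[w, z]`, where `u, v, w, z` lie in the set `T`
of all roots of `Q`, and yet every primitive is larger at `z` than at `u`. -/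
structure HasReversedExtrema (Q : ℝ[X]) (T : Finset ℝ) (u v w z : ℝ) : Prop where
  isRoot_iff : ∀ x, Q.IsRoot x ↔ x ∈ T
  left_mem : u ∈ T
  left_mem' : v ∈ T
  right_mem : w ∈ T
  right_mem' : z ∈ T
  left_lt : u < v
  right_lt : w < z
  neg_left : ∀ x ∈ Set.Ioo u v, Q.eval x < 0
  neg_right : ∀ x ∈ Set.Ioo w z, Q.eval x < 0
  integral_pos : 0 < ∫ x in u..z, Q.eval x

theorem Polynomial.integral_eval_derivative (P : ℝ[X]) (a b : ℝ) :
    ∫ x in a..b, P.derivative.eval x = P.eval b - P.eval a :=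
  intervalIntegral.integral_eq_sub_of_hasDerivAt (fun x _ => P.hasDerivAt x)
    (P.derivative.continuous.intervalIntegrable _ _)

theorem Polynomial.strictAntiOn_of_derivative_neg {P : ℝ[X]} {a b : ℝ}
    (h : ∀ x ∈ Set.Ioo a b, P.derivative.eval x < 0) :
    StrictAntiOn (fun x => P.eval x) (Set.Icc a b) := by
  refine strictAntiOn_of_deriv_neg (convex_Icc a b) P.continuous.continuousOn fun x hx => ?_
  rw [interior_Icc] at hx
  simpa using h x hx

/-- A polynomial takes each value at most as often as its derivative vanishes, when the extrema of
the polynomial are reversed. -/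
theorem HasReversedExtrema.card_le {P : ℝ[X]} {T : Finset ℝ} {u v w z : ℝ}
    (h : HasReversedExtrema P.derivative T u v w z) {c : ℝ} {S : Finset ℝ}
    (hS : ∀ x ∈ S, P.eval x = c) : S.card ≤ T.card := by
  have huz : P.eval u < P.eval z := by
    simpa [Polynomial.integral_eval_derivative] using h.integral_pos
  have hanti := Polynomial.strictAntiOn_of_derivative_neg h.neg_left
  have hanti' := Polynomial.strictAntiOn_of_derivative_neg h.neg_right
  have rolle : ∀ x ∈ S, ∀ y ∈ S, x < y → ∃ r ∈ T, x < r ∧ r < y := by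
    intro x hx y hy hxy
    obtain ⟨r, hr, hr'⟩ := exists_deriv_eq_zero hxy P.continuous.continuousOn
      ((hS x hx).trans (hS y hy).symm)
    exact ⟨r, (h.isRoot_iff r).1 (by simpa using hr'), hr.1, hr.2⟩
  have key : ∀ t ∈ T, (∀ x ∈ S, ∀ y ∈ S, x < t → t < y → ∃ r ∈ T, r ≠ t ∧ x < r ∧ r < y) →
      S.card ≤ T.card := by
    intro t ht hstep
    rw [← Finset.card_erase_add_one ht]
    refine Finset.card_le_of_interleaved fun x hx y hy hxy _ => ?_
    obtain ⟨r, hrT, hxr, hry⟩ := rolle x hx y hy hxy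
    by_cases hrt : r = t
    · subst hrt
      obtain ⟨s, hsT, hsr, hs⟩ := hstep x hx y hy hxr hry
      exact ⟨s, Finset.mem_erase.2 ⟨hsr, hsT⟩, hs⟩
    · exact ⟨r, Finset.mem_erase.2 ⟨hrt, hrT⟩, hxr, hry⟩
  rcases le_or_gt (P.eval u) c with hc | hc
  · refine key u h.left_mem fun x _ y hy hxu huy =>
      ⟨v, h.left_mem', h.left_lt.ne', hxu.trans h.left_lt, ?_⟩
    by_contra! hyv
    have := hanti (Set.left_mem_Icc.2 h.left_lt.le) ⟨huy.le, hyv⟩ huy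
    simp only [hS y hy] at this
    linarith
  · refine key z h.right_mem' fun x hx y _ hxz hzy =>
      ⟨w, h.right_mem, h.right_lt.ne, ?_, h.right_lt.trans hzy⟩
    by_contra! hwx
    have := hanti' ⟨hwx, hxz.le⟩ (Set.right_mem_Icc.2 h.right_lt.le) hxz
    simp only [hS x hx] at this
    linarith

theorem HasReversedExtrema.not_exists_injective {P : ℝ[X]} {T : Finset ℝ} {u v w z : ℝ}
    (h : HasReversedExtrema P.derivative T u v w z) {n : ℕ} (hn : T.card < n) (c : ℝ) :
    ¬∃ a : Fin n → ℝ, Function.Injective a ∧ ∀ i, (P - C c).IsRoot (a i) := by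
  rintro ⟨a, ha, hroot⟩
  have := h.card_le (c := c) (S := Finset.univ.image a) (by
    simpa [sub_eq_zero] using hroot)
  rw [Finset.card_image_of_injective _ ha, Finset.card_univ, Fintype.card_fin] at this
  omega

/-- One more root can be added far to the left. -/
theorem HasReversedExtrema.exists_insert {Q : ℝ[X]} {T : Finset ℝ} {u v w z : ℝ}
    (h : HasReversedExtrema Q T u v w z) :
    ∃ Q' : ℝ[X], ∃ r ∉ T, Q'.natDegree = Q.natDegree + 1 ∧
      HasReversedExtrema Q' (insert r T) u v w z := by
  have hQ : Q ≠ 0 := by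
    rintro rfl
    simpa using h.integral_pos
  have hev : ∀ᶠ ε : ℝ in nhdsWithin 0 (Set.Ioi 0), (∀ t ∈ T, 0 < 1 + ε * t) ∧
      0 < (∫ x in u..z, Q.eval x) + ε * ∫ x in u..z, x * Q.eval x := by
    refine Filter.Eventually.filter_mono nhdsWithin_le_nhds (Filter.Eventually.and ?_ ?_)
    · rw [Filter.eventually_all_finset]
      intro t _
      refine ContinuousAt.eventually_lt (by fun_prop) (by fun_prop) ?_
      simp
    · refine ContinuousAt.eventually_lt (by fun_prop) (by fun_prop) ?_
      simpa using h.integral_pos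
  obtain ⟨ε, ⟨hT, hI⟩, hε : 0 < ε⟩ := (hev.and self_mem_nhdsWithin).exists
  have hfactor : ∀ t ∈ T, ∀ x, t < x → 0 < 1 + ε * x := fun t ht x hx => by
    nlinarith [hT t ht]
  have heval : ∀ x, ((C ε * X + C 1) * Q).eval x = (1 + ε * x) * Q.eval x := fun x => by
    rw [eval_mul, eval_add, eval_mul, eval_C, eval_C, eval_X, add_comm]
  refine ⟨(C ε * X + C 1) * Q, -ε⁻¹, fun hr => ?_, ?_, ?_⟩
  · have := hT _ hr
    simp [hε.ne'] at this
  · rw [natDegree_mul (fun h0 => ?_) hQ, natDegree_linear hε.ne', add_comm]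
    simpa using congrArg (eval 0) h0
  · refine ⟨fun x => ?_, Finset.mem_insert_of_mem h.left_mem, Finset.mem_insert_of_mem h.left_mem',
      Finset.mem_insert_of_mem h.right_mem, Finset.mem_insert_of_mem h.right_mem', h.left_lt,
      h.right_lt, fun x hx => ?_, fun x hx => ?_, ?_⟩
    · rw [IsRoot.def, heval, mul_eq_zero, Finset.mem_insert, ← h.isRoot_iff, IsRoot.def]
      refine or_congr_left ⟨fun hx => ?_, fun hx => ?_⟩
      · field_simp
        linarith
      · rw [hx]
        field_simp
        ring
    · rw [heval]
      exact mul_neg_of_pos_of_neg (hfactor u h.left_mem x hx.1) (h.neg_left x hx)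
    · rw [heval]
      exact mul_neg_of_pos_of_neg (hfactor w h.right_mem x hx.1) (h.neg_right x hx)
    · have hsum : ∀ x, ((C ε * X + C 1) * Q).eval x = Q.eval x + ε * (x * Q.eval x) := fun x => by
        rw [heval]; ring
      have hcont := Q.continuous
      simp only [hsum]
      rwa [intervalIntegral.integral_add (hcont.intervalIntegrable _ _)
        (Continuous.intervalIntegrable (by fun_prop) _ _), intervalIntegral.integral_const_mul]

/-- The primitive of `5X(X − 1)(X − 3)(X − π)` vanishing at `0`. -/
noncomputable def piQuintic : ℝ[X] :=
  X ^ 5 - C (5 * Real.pi / 4 + 5) * X ^ 4 + C (20 * Real.pi / 3 + 5) * X ^ 3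
    - C (15 * Real.pi / 2) * X ^ 2

theorem eval_derivative_piQuintic (x : ℝ) :
    piQuintic.derivative.eval x = 5 * (x * (x - 1) * (x - 3) * (x - Real.pi)) := by
  simp [piQuintic]
  ring

theorem hasReversedExtrema_piQuintic :
    HasReversedExtrema piQuintic.derivative {0, 1, 3, Real.pi} 0 1 3 Real.pi := by
  have hπ := Real.pi_gt_three
  have hπ' := Real.pi_lt_d2
  refine ⟨fun x => ?_, by simp, by simp, by simp, by simp, one_pos, hπ, ?_, ?_, ?_⟩
  · rw [IsRoot.def, eval_derivative_piQuintic]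
    simp [sub_eq_zero, or_assoc]
  · rintro x ⟨h0, h1⟩
    rw [eval_derivative_piQuintic]
    have h2 : 0 < x * (1 - x) * ((3 - x) * (Real.pi - x)) :=
      mul_pos (mul_pos h0 (by linarith)) (mul_pos (by linarith) (by linarith))
    linarith
  · rintro x ⟨h0, h1⟩
    rw [eval_derivative_piQuintic]
    have h2 : 0 < x * (x - 1) * ((x - 3) * (Real.pi - x)) :=
      mul_pos (mul_pos (by linarith) (by linarith)) (mul_pos (by linarith) (by linarith))
    linarith
  · rw [Polynomial.integral_eval_derivative]
    have hfac : piQuintic.eval Real.pi - piQuintic.eval 0 =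
        Real.pi ^ 3 * (-Real.pi ^ 2 / 4 + 5 * Real.pi / 3 - 5 / 2) := by
      simp [piQuintic]
      ring
    rw [hfac]
    exact mul_pos (by positivity) (by nlinarith)

theorem card_piQuintic_critical : ({0, 1, 3, Real.pi} : Finset ℝ).card = 4 := by
  have hπ := Real.pi_gt_three
  rw [Finset.card_insert_of_notMem, Finset.card_insert_of_notMem, Finset.card_pair hπ.ne]
  · simp only [Finset.mem_insert, Finset.mem_singleton, not_or]
    exact ⟨by norm_num, by linarith⟩
  · simp only [Finset.mem_insert, Finset.mem_singleton, not_or]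
    exact ⟨by norm_num, by norm_num, by linarith⟩

theorem natDegree_derivative_piQuintic : piQuintic.derivative.natDegree = 4 := by
  have h : piQuintic.natDegree = 5 := by
    unfold piQuintic
    compute_degree!
  rw [natDegree_derivative, h]

theorem exists_hasReversedExtrema (k : ℕ) :
    ∃ (Q : ℝ[X]) (T : Finset ℝ) (u v w z : ℝ), Q.natDegree = k + 4 ∧ T.card = k + 4 ∧
      HasReversedExtrema Q T u v w z := by
  induction k with
  | zero =>
    exact ⟨_, _, _, _, _, _, natDegree_derivative_piQuintic, card_piQuintic_critical,
      hasReversedExtrema_piQuintic⟩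
  | succ k ih =>
    obtain ⟨Q, T, u, v, w, z, hdeg, hcard, h⟩ := ih
    obtain ⟨Q', r, hr, hdeg', h'⟩ := h.exists_insert
    refine ⟨Q', insert r T, u, v, w, z, by omega, ?_, h'⟩
    rw [Finset.card_insert_of_notMem hr]
    omega

/-- for every `n ≥ 5` there is a real polynomial `Q` of degree
`n−1` with `n−1` distinct real roots such that for every `c ∈ ℝ` the
polynomial `∫₀^X Q(t)dt − c` does not have `n` distinct real roots.  In
particular, for `n = 5` and `Q(X) = 5X(X−1)(X−3)(X−π)`: for every `c`, the
quintic `X⁵ − (5π/4 + 5)X⁴ + (20π/3 + 5)X³ − (15π/2)X² − c` does not have `5`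
distinct real roots. -/
theorem stmt_19 :
    (∀ n : ℕ, 5 ≤ n →
      ∃ Q : Polynomial ℝ, Q.natDegree = n - 1 ∧
        (∃ b : Fin (n - 1) → ℝ, Function.Injective b ∧ ∀ i, Q.IsRoot (b i)) ∧
        ∀ P : Polynomial ℝ, P.derivative = Q → P.eval 0 = 0 →
          ∀ c : ℝ,
            ¬∃ a : Fin n → ℝ, Function.Injective a ∧ ∀ i, (P - C c).IsRoot (a i)) ∧
    (∀ c : ℝ,
      ¬∃ a : Fin 5 → ℝ, Function.Injective a ∧ ∀ i,
        (X ^ 5 - C (5 * Real.pi / 4 + 5) * X ^ 4 + C (20 * Real.pi / 3 + 5) * X ^ 3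
          - C (15 * Real.pi / 2) * X ^ 2 - C c).IsRoot (a i)) := by
  refine ⟨fun n hn => ?_, fun c => ?_⟩
  · obtain ⟨Q, T, u, v, w, z, hdeg, hcard, h⟩ := exists_hasReversedExtrema (n - 5)
    refine ⟨Q, by omega, ⟨T.orderEmbOfFin (by omega), (T.orderEmbOfFin _).injective,
      fun i => (h.isRoot_iff _).2 (T.orderEmbOfFin_mem _ i)⟩, ?_⟩
    rintro P rfl - c
    exact h.not_exists_injective (by omega) c
  · exact hasReversedExtrema_piQuintic.not_exists_injective
      (by rw [card_piQuintic_critical]; norm_num) c
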